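/- Assume ε > 0, λ > λ₀, and Condition A. Then there exist five 2π-periodic solutions u₁, u₂, u₃, u₄, u₅ of (∗) on ℝ, each satisfying u_i'(0) = 0 and u_i'(π) = 0, such that u₁(t) < u₂(t) < u₃(t) < u₄(t) < u₅(t) for all t ∈ ℝ. -/

import Mathlib

open Real Set

/-- `u` is a `2π`-periodic solution of the forced Duffing equation
`ε²·u'' = u³ − λ·u + cos t` on `ℝ` with `u'(0) = 0` and `u'(π) = 0`. -/
def IsPeriodicBdySol (ε lam : ℝ) (u : ℝ → ℝ) : Prop :=
  ContDiff ℝ 2 u ∧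
  (∀ t : ℝ, ε ^ 2 * deriv (deriv u) t = u t ^ 3 - lam * u t + Real.cos t) ∧
  Function.Periodic u (2 * Real.pi) ∧ deriv u 0 = 0 ∧ deriv u Real.pi = 0

/-! ### One-sided derivative tests -/

/-- A function maximal at the left endpoint has nonpositive derivative there. -/
lemma deriv_nonpos_of_max_left {d : ℝ → ℝ} {a b m : ℝ} (hab : a < b) (hd : HasDerivAt d m a)
    (hmax : ∀ t ∈ Icc a b, d t ≤ d a) : m ≤ 0 := by
  by_contra! hm
  have h1 := (hasDerivAt_iff_tendsto_slope.1 hd).eventually (lt_mem_nhds hm)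
  have h2 : ∀ᶠ t in nhdsWithin a (Ioi a), 0 < slope d a t :=
    h1.filter_mono (nhdsWithin_mono a fun x hx => ne_of_gt hx)
  obtain ⟨t, ht, hat, htb⟩ := (h2.and (Ioo_mem_nhdsGT hab)).exists
  rw [slope_def_field, lt_div_iff₀ (by linarith)] at ht
  linarith [hmax t ⟨hat.le, htb.le⟩]

/-- Second derivative test for a maximum at the left endpoint. -/
lemma second_deriv_nonpos_of_max_left {d q : ℝ → ℝ} {a b c : ℝ} (hab : a < b)
    (hd : ∀ t ∈ Icc a b, HasDerivAt d (q t) t) (hq : HasDerivAt q c a) (hqa : 0 ≤ q a)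
    (hmax : ∀ t ∈ Icc a b, d t ≤ d a) : c ≤ 0 := by
  by_contra! hc
  have h1 := (hasDerivAt_iff_tendsto_slope.1 hq).eventually (lt_mem_nhds hc)
  have h2 : ∀ᶠ t in nhdsWithin a (Ioi a), 0 < slope q a t :=
    h1.filter_mono (nhdsWithin_mono a fun x hx => ne_of_gt hx)
  obtain ⟨e, hae, he⟩ := (mem_nhdsGT_iff_exists_Ioo_subset).1 h2
  have hae' : a < e := hae
  obtain ⟨x, hx1, hx2⟩ := exists_between (lt_min hab hae')
  have hxb : x < b := hx2.trans_le (min_le_left _ _)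
  have hxe : x < e := hx2.trans_le (min_le_right _ _)
  obtain ⟨y, hy, hyq⟩ := exists_hasDerivAt_eq_slope d q hx1
    (fun t ht => (hd t ⟨ht.1, ht.2.trans hxb.le⟩).continuousAt.continuousWithinAt)
    (fun t ht => hd t ⟨ht.1.le, ht.2.le.trans hxb.le⟩)
  have hpos : 0 < slope q a y := he ⟨hy.1, hy.2.trans hxe⟩
  rw [slope_def_field, lt_div_iff₀ (by linarith [hy.1])] at hpos
  rw [eq_div_iff (by linarith)] at hyq
  have := hmax x ⟨hx1.le, hxb.le⟩
  have : 0 < q y * (x - a) := mul_pos (by linarith) (by linarith)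
  linarith

lemma hasDerivAt_comp_neg' {f : ℝ → ℝ} {m x : ℝ} (hf : HasDerivAt f m (-x)) :
    HasDerivAt (fun t => f (-t)) (-m) x := by
  have h := HasDerivAt.comp_const_sub 0 x (f := f) (f' := m) (by simpa using hf)
  simpa using h

/-- A function maximal at the right endpoint has nonnegative derivative there. -/
lemma deriv_nonneg_of_max_right {d : ℝ → ℝ} {a b m : ℝ} (hab : a < b) (hd : HasDerivAt d m b)
    (hmax : ∀ t ∈ Icc a b, d t ≤ d b) : 0 ≤ m := by
  have h := deriv_nonpos_of_max_left (d := fun t => d (-t)) (m := -m) (neg_lt_neg hab)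
    (hasDerivAt_comp_neg' (by simpa using hd))
    (fun t ht => by simpa using hmax (-t) ⟨by linarith [ht.2], by linarith [ht.1]⟩)
  linarith

/-- Second derivative test for a maximum at the right endpoint. -/
lemma second_deriv_nonpos_of_max_right {d q : ℝ → ℝ} {a b c : ℝ} (hab : a < b)
    (hd : ∀ t ∈ Icc a b, HasDerivAt d (q t) t) (hq : HasDerivAt q c b) (hqb : q b ≤ 0)
    (hmax : ∀ t ∈ Icc a b, d t ≤ d b) : c ≤ 0 := by
  refine second_deriv_nonpos_of_max_left (d := fun t => d (-t)) (q := fun t => -q (-t))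
    (neg_lt_neg hab) (fun t ht => ?_) ?_ (by simpa using hqb)
    (fun t ht => by simpa using hmax (-t) ⟨by linarith [ht.2], by linarith [ht.1]⟩)
  · exact hasDerivAt_comp_neg' (hd (-t) ⟨by linarith [ht.2], by linarith [ht.1]⟩)
  · simpa using (hasDerivAt_comp_neg' (x := -b) (by simpa using hq)).fun_neg

/-- Second derivative test on a closed interval under Neumann-type inequalities
at the endpoints. -/
lemma second_deriv_nonpos_of_max {d q : ℝ → ℝ} {a b t₀ c : ℝ} (hab : a < b) (ht₀ : t₀ ∈ Icc a b)
    (hd : ∀ t ∈ Icc a b, HasDerivAt d (q t) t) (hq : HasDerivAt q c t₀)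
    (hqa : 0 ≤ q a) (hqb : q b ≤ 0) (hmax : ∀ t ∈ Icc a b, d t ≤ d t₀) : c ≤ 0 := by
  rcases ht₀.2.eq_or_lt with rfl | hlt
  · exact second_deriv_nonpos_of_max_right hab hd hq hqb hmax
  · refine second_deriv_nonpos_of_max_left hlt (fun t ht => hd t ⟨ht₀.1.trans ht.1, ht.2⟩) hq ?_
      (fun t ht => hmax t ⟨ht₀.1.trans ht.1, ht.2⟩)
    rcases ht₀.1.eq_or_lt with rfl | hgt
    · exact hqa
    · exact deriv_nonneg_of_max_right hgt (hd t₀ ht₀)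
        (fun t ht => hmax t ⟨ht.1, ht.2.trans ht₀.2⟩)

/-- First derivative test on a closed interval under Neumann conditions at the endpoints. -/
lemma deriv_eq_zero_of_max {d q : ℝ → ℝ} {a b t₀ : ℝ} (ht₀ : t₀ ∈ Icc a b)
    (hd : ∀ t ∈ Icc a b, HasDerivAt d (q t) t)
    (hqa : q a = 0) (hqb : q b = 0) (hmax : ∀ t ∈ Icc a b, d t ≤ d t₀) : q t₀ = 0 := by
  rcases ht₀.2.eq_or_lt with rfl | hlt
  · exact hqb
  rcases ht₀.1.eq_or_lt with rfl | hgt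
  · exact hqa
  exact le_antisymm
    (deriv_nonpos_of_max_left hlt (hd t₀ ht₀) (fun t ht => hmax t ⟨ht₀.1.trans ht.1, ht.2⟩))
    (deriv_nonneg_of_max_right hgt (hd t₀ ht₀) (fun t ht => hmax t ⟨ht.1, ht.2.trans ht₀.2⟩))

/-! ### Solutions of second order equations -/

/-- `u`, with derivative `p`, solves `u'' = f t u` on `[a, b]`. -/
def IsSolOn (f : ℝ → ℝ → ℝ) (a b : ℝ) (u p : ℝ → ℝ) : Prop :=
  ∀ t ∈ Icc a b, HasDerivAt u (p t) t ∧ HasDerivAt p (f t (u t)) t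

lemma IsSolOn.continuousOn {f : ℝ → ℝ → ℝ} {a b : ℝ} {u p : ℝ → ℝ} (h : IsSolOn f a b u p) :
    ContinuousOn u (Icc a b) := fun t ht => (h t ht).1.continuousAt.continuousWithinAt

lemma IsSolOn.congr {f g : ℝ → ℝ → ℝ} {a b : ℝ} {u p : ℝ → ℝ} (h : IsSolOn f a b u p)
    (hfg : ∀ t ∈ Icc a b, f t (u t) = g t (u t)) : IsSolOn g a b u p :=
  fun t ht => ⟨(h t ht).1, hfg t ht ▸ (h t ht).2⟩

/-- Growth estimate for the distance in phase space between two solutions. -/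
lemma IsSolOn.dist_sq_le {f : ℝ → ℝ → ℝ} {a b K : ℝ} {u p v q : ℝ → ℝ} (hu : IsSolOn f a b u p)
    (hv : IsSolOn f a b v q) (hK0 : 0 ≤ K)
    (hK : ∀ t ∈ Icc a b, |f t (u t) - f t (v t)| ≤ K * |u t - v t|)
    {s t : ℝ} (hs : s ∈ Icc a b) (ht : t ∈ Icc a b) :
    (u t - v t) ^ 2 + (p t - q t) ^ 2 ≤
      ((u s - v s) ^ 2 + (p s - q s) ^ 2) * exp ((1 + K) * |t - s|) := by
  set E : ℝ → ℝ := fun t => (u t - v t) ^ 2 + (p t - q t) ^ 2 with hE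
  set E' : ℝ → ℝ := fun t => 2 * (u t - v t) * (p t - q t) +
    2 * (p t - q t) * (f t (u t) - f t (v t)) with hE'
  have hderiv : ∀ t ∈ Icc a b, HasDerivAt E (E' t) t := fun t ht => by
    have h1 := (((hu t ht).1.sub (hv t ht).1).pow 2).add (((hu t ht).2.sub (hv t ht).2).pow 2)
    refine HasDerivAt.congr_deriv (f := E) h1 ?_
    simp only [hE', Pi.sub_apply]
    push_cast
    ring
  have hbound : ∀ t ∈ Icc a b, |E' t| ≤ (1 + K) * E t := fun t ht => by
    have h1 := hK t ht
    have h2 : |E' t| ≤ 2 * |u t - v t| * |p t - q t| +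
        2 * |p t - q t| * |f t (u t) - f t (v t)| := by
      refine (abs_add_le _ _).trans (le_of_eq ?_)
      simp [abs_mul]
    have h3 : |p t - q t| * |f t (u t) - f t (v t)| ≤ |p t - q t| * (K * |u t - v t|) :=
      mul_le_mul_of_nonneg_left h1 (abs_nonneg _)
    have h4 : E t = |u t - v t| ^ 2 + |p t - q t| ^ 2 := by simp [hE, sq_abs]
    rw [h4]
    nlinarith [mul_nonneg hK0 (sq_nonneg (|u t - v t| - |p t - q t|)),
      sq_nonneg (|u t - v t| - |p t - q t|)]
  have hexp : ∀ k x : ℝ, HasDerivAt (fun t => exp (k * t)) (exp (k * x) * k) x := fun k x => by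
    simpa using ((hasDerivAt_id x).const_mul k).exp
  have hmono : MonotoneOn (fun t => E t * exp ((1 + K) * t)) (Icc a b) := by
    refine monotoneOn_of_hasDerivWithinAt_nonneg (convex_Icc a b)
      (fun x hx => ((hderiv x hx).mul (hexp (1 + K) x)).continuousAt.continuousWithinAt)
      (fun x hx => ((hderiv x (interior_subset hx)).mul (hexp (1 + K) x)).hasDerivWithinAt)
      (fun x hx => ?_)
    have h1 := (abs_le.1 (hbound x (interior_subset hx))).1
    nlinarith [exp_pos ((1 + K) * x)]
  have hanti : AntitoneOn (fun t => E t * exp (-(1 + K) * t)) (Icc a b) := by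
    refine antitoneOn_of_hasDerivWithinAt_nonpos (convex_Icc a b)
      (fun x hx => ((hderiv x hx).mul (hexp (-(1 + K)) x)).continuousAt.continuousWithinAt)
      (fun x hx => ((hderiv x (interior_subset hx)).mul (hexp (-(1 + K)) x)).hasDerivWithinAt)
      (fun x hx => ?_)
    have h1 := (abs_le.1 (hbound x (interior_subset hx))).2
    nlinarith [exp_pos (-(1 + K) * x)]
  change E t ≤ E s * _
  rcases le_total s t with hst | hst
  · rw [abs_of_nonneg (sub_nonneg.2 hst)]
    have h1 : E t * exp (-(1 + K) * t) ≤ E s * exp (-(1 + K) * s) := hanti hs ht hst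
    have h2 : exp ((1 + K) * (t - s)) = exp (-(1 + K) * s) * exp ((1 + K) * t) := by
      rw [← exp_add]; ring_nf
    have h3 : exp (-(1 + K) * t) * exp ((1 + K) * t) = 1 := by
      rw [← exp_add]; ring_nf; simp
    have h4 := mul_le_mul_of_nonneg_right h1 (exp_pos ((1 + K) * t)).le
    rwa [mul_assoc, h3, mul_one, mul_assoc, ← h2] at h4
  · rw [abs_of_nonpos (sub_nonpos.2 hst)]
    have h1 : E t * exp ((1 + K) * t) ≤ E s * exp ((1 + K) * s) := hmono ht hs hst
    have h2 : exp ((1 + K) * -(t - s)) = exp ((1 + K) * s) * exp (-(1 + K) * t) := by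
      rw [← exp_add]; ring_nf
    have h3 : exp ((1 + K) * t) * exp (-(1 + K) * t) = 1 := by
      rw [← exp_add]; ring_nf; simp
    have h4 := mul_le_mul_of_nonneg_right h1 (exp_pos (-(1 + K) * t)).le
    rwa [mul_assoc, h3, mul_one, mul_assoc, ← h2] at h4

/-- Two solutions with the same position and velocity at one time coincide. -/
lemma IsSolOn.unique {f : ℝ → ℝ → ℝ} {a b K : ℝ} {u p v q : ℝ → ℝ} (hu : IsSolOn f a b u p)
    (hv : IsSolOn f a b v q) (hK0 : 0 ≤ K)
    (hK : ∀ t ∈ Icc a b, |f t (u t) - f t (v t)| ≤ K * |u t - v t|)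
    {s t : ℝ} (hs : s ∈ Icc a b) (ht : t ∈ Icc a b) (h0 : u s = v s) (h1 : p s = q s) :
    u t = v t ∧ p t = q t := by
  have h := hu.dist_sq_le hv hK0 hK hs ht
  rw [h0, h1] at h
  have h' : (u t - v t) ^ 2 + (p t - q t) ^ 2 ≤ 0 := by simpa using h
  constructor <;> nlinarith [sq_nonneg (u t - v t), sq_nonneg (p t - q t)]

/-- Global solvability of the initial value problem `u'' = g t u`, `u a = x₀`, `u' a = 0`
for a bounded right-hand side that is Lipschitz in the unknown. -/
lemma exists_isSolOn {g : ℝ → ℝ → ℝ} {a b C K : ℝ} (hab : a ≤ b) (hK0 : 0 ≤ K)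
    (hcont : ∀ x, ContinuousOn (fun t => g t x) (Icc a b))
    (hlip : ∀ t ∈ Icc a b, ∀ x y, |g t x - g t y| ≤ K * |x - y|)
    (hbd : ∀ t ∈ Icc a b, ∀ x, |g t x| ≤ C) (x₀ : ℝ) :
    ∃ u p : ℝ → ℝ, IsSolOn g a b u p ∧ u a = x₀ ∧ p a = 0 := by
  lift K to NNReal using hK0
  have hC : 0 ≤ C := (abs_nonneg _).trans (hbd a ⟨le_rfl, hab⟩ 0)
  set M : ℝ := C * (b - a) with hM
  have hM0 : 0 ≤ M := mul_nonneg hC (by linarith)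
  set X : ℝ → ℝ × ℝ → ℝ × ℝ := fun t z => (max (-M) (min M z.2), g (projIcc a b hab t) z.1) with hX
  set L : NNReal := ⟨max M C, le_max_of_le_left hM0⟩ with hL
  have hclamp : LipschitzWith 1 fun y : ℝ => max (-M) (min M y) :=
    (LipschitzWith.id.const_min M).const_max (-M)
  have hg : ∀ t, LipschitzWith K fun x => g (projIcc a b hab t) x := fun t =>
    LipschitzWith.of_dist_le_mul fun x y => hlip _ (projIcc a b hab t).2 x y
  set N : NNReal := ⟨b - a + 1, by linarith⟩ with hN
  let t₀ : Icc (a - 1) (b + 1) := ⟨a, by constructor <;> linarith⟩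
  have hPL : IsPicardLindelof X t₀ ((x₀, 0) : ℝ × ℝ)
      (L * N) 0 L (max 1 K) := by
    refine ⟨fun t _ => LipschitzWith.lipschitzOnWith ?_, fun z _ => ?_, fun t _ z _ => ?_, ?_⟩
    · have h1 : LipschitzWith 1 fun z : ℝ × ℝ => max (-M) (min M z.2) := by
        simpa [Function.comp_def] using hclamp.comp LipschitzWith.prod_snd
      have h2 : LipschitzWith K fun z : ℝ × ℝ => g (projIcc a b hab t) z.1 := by
        simpa [Function.comp_def] using (hg t).comp LipschitzWith.prod_fst
      exact h1.prodMk h2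
    · refine ContinuousOn.prodMk continuousOn_const (Continuous.continuousOn ?_)
      exact (continuousOn_iff_continuous_domRestrict.1 (hcont z.1)).comp continuous_projIcc
    · rw [Prod.norm_def]
      refine max_le_max ?_ (hbd _ (projIcc a b hab t).2 _)
      rw [Real.norm_eq_abs, abs_le]
      exact ⟨le_max_left _ _, max_le (by linarith) (min_le_left _ _)⟩
    · have h1 : max (b + 1 - a) (a - (a - 1)) = b - a + 1 := by
        rw [max_eq_left] <;> linarith
      change (L : ℝ) * max (b + 1 - a) (a - (a - 1)) ≤ ↑(L * N) - 0
      rw [h1, sub_zero]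
      rw [NNReal.coe_mul]
      exact le_rfl
  obtain ⟨α, hα0, hα⟩ := hPL.exists_eq_forall_mem_Icc_hasDerivWithinAt₀
  have hder : ∀ t ∈ Icc a b, HasDerivAt α (X t (α t)) t := fun t ht =>
    (hα t ⟨by linarith [ht.1], by linarith [ht.2]⟩).hasDerivAt
      (Icc_mem_nhds (by linarith [ht.1]) (by linarith [ht.2]))
  have hfst : ∀ t ∈ Icc a b, HasDerivAt (fun s => (α s).1) (max (-M) (min M (α t).2)) t :=
    fun t ht => (hasDerivAt_iff_hasFDerivAt.1 (hder t ht)).fst.hasDerivAt.congr_deriv (by simp [hX])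
  have hsnd : ∀ t ∈ Icc a b, HasDerivAt (fun s => (α s).2) (g t (α t).1) t := fun t ht =>
    (hasDerivAt_iff_hasFDerivAt.1 (hder t ht)).snd.hasDerivAt.congr_deriv
      (by simp [hX, projIcc_of_mem hab ht])
  have ha1 : α a = (x₀, 0) := hα0
  have hbound : ∀ t ∈ Icc a b, |(α t).2| ≤ M := fun t ht => by
    have h := Convex.norm_image_sub_le_of_norm_hasDerivWithin_le (f := fun s => (α s).2)
      (fun s hs => (hsnd s hs).hasDerivWithinAt) (fun s hs => hbd s hs _) (convex_Icc a b)
      ⟨le_rfl, hab⟩ ht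
    rw [ha1] at h
    simp only [sub_zero, Real.norm_eq_abs] at h
    refine h.trans (mul_le_mul_of_nonneg_left ?_ hC)
    rw [abs_of_nonneg (by linarith [ht.1])]
    linarith [ht.2]
  refine ⟨fun s => (α s).1, fun s => (α s).2, fun t ht => ⟨?_, hsnd t ht⟩, by simp [ha1],
    by simp [ha1]⟩
  have h := abs_le.1 (hbound t ht)
  have h2 := hfst t ht
  rwa [min_eq_right h.2, max_eq_right h.1] at h2

/-- Truncation of `f` between `l` and `r`, modified outside by a bounded monotone term. -/
def trunc (f : ℝ → ℝ → ℝ) (l r : ℝ → ℝ) (t x : ℝ) : ℝ :=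
  f t (max (l t) (min (r t) x)) + max (-1) (min 1 (x - max (l t) (min (r t) x)))

/-- Continuous nonlinearities, locally Lipschitz in the unknown uniformly in time. -/
structure Regular (f : ℝ → ℝ → ℝ) : Prop where
  cont : Continuous fun z : ℝ × ℝ => f z.1 z.2
  lip : ∀ R : ℝ, ∃ K : ℝ, 0 ≤ K ∧ ∀ t x y, |x| ≤ R → |y| ≤ R → |f t x - f t y| ≤ K * |x - y|

section Trunc

variable {f : ℝ → ℝ → ℝ} {l r : ℝ → ℝ} {a b : ℝ}

lemma trunc_of_mem {t x : ℝ} (h1 : l t ≤ x) (h2 : x ≤ r t) : trunc f l r t x = f t x := by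
  simp [trunc, min_eq_right h2, max_eq_right h1]

lemma trunc_of_gt {t x : ℝ} (h : l t ≤ r t) (hx : r t < x) : f t (r t) < trunc f l r t x := by
  have : 0 < min 1 (x - r t) := lt_min one_pos (by linarith)
  simp only [trunc, min_eq_left hx.le, max_eq_right h]
  linarith [le_max_right (-1) (min 1 (x - r t))]

lemma trunc_continuousOn (hf : Regular f) (hl : ContinuousOn l (Icc a b))
    (hr : ContinuousOn r (Icc a b)) (x : ℝ) :
    ContinuousOn (fun t => trunc f l r t x) (Icc a b) := by
  have h1 : ContinuousOn (fun t => max (l t) (min (r t) x)) (Icc a b) :=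
    hl.sup (hr.inf continuousOn_const)
  have h2 : ContinuousOn (fun t => f t (max (l t) (min (r t) x))) (Icc a b) :=
    hf.cont.comp_continuousOn (continuousOn_id.prodMk h1)
  exact h2.add (continuousOn_const.sup (continuousOn_const.inf (continuousOn_const.sub h1)))

lemma trunc_lipschitz (hf : Regular f) (hl : ContinuousOn l (Icc a b))
    (hr : ContinuousOn r (Icc a b)) :
    ∃ K, 0 ≤ K ∧ ∀ t ∈ Icc a b, ∀ x y, |trunc f l r t x - trunc f l r t y| ≤ K * |x - y| := by
  obtain ⟨A, hA⟩ := isCompact_Icc.exists_bound_of_continuousOn hl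
  obtain ⟨B, hB⟩ := isCompact_Icc.exists_bound_of_continuousOn hr
  obtain ⟨K, hK0, hK⟩ := hf.lip (max A B)
  refine ⟨K + 2, by linarith, fun t ht x y => ?_⟩
  have hin : ∀ x, |max (l t) (min (r t) x)| ≤ max A B := fun x => by
    have h1 := abs_le.1 (hA t ht)
    have h2 := abs_le.1 (hB t ht)
    refine abs_le.2 ⟨?_, ?_⟩
    · exact (by linarith [h1.1, le_max_left A B] : -max A B ≤ l t).trans (le_max_left _ _)
    · exact max_le (h1.2.trans (le_max_left _ _))
        ((min_le_left _ _).trans (h2.2.trans (le_max_right _ _)))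
  have hcl : ∀ c d x y : ℝ, |max c (min d x) - max c (min d y)| ≤ |x - y| := fun c d x y => by
    simpa [Real.dist_eq] using ((LipschitzWith.id.const_min d).const_max c).dist_le_mul x y
  have h1 := hK t _ _ (hin x) (hin y)
  have h2 := hcl (l t) (r t) x y
  have h3 := hcl (-1) 1 (x - max (l t) (min (r t) x)) (y - max (l t) (min (r t) y))
  have h4 : |x - max (l t) (min (r t) x) - (y - max (l t) (min (r t) y))| ≤ 2 * |x - y| := by
    have : x - max (l t) (min (r t) x) - (y - max (l t) (min (r t) y)) =
      (x - y) - (max (l t) (min (r t) x) - max (l t) (min (r t) y)) := by ring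
    rw [this]
    linarith [abs_sub (x - y) (max (l t) (min (r t) x) - max (l t) (min (r t) y))]
  have h5 := mul_le_mul_of_nonneg_left h2 hK0
  calc |trunc f l r t x - trunc f l r t y|
      ≤ |f t (max (l t) (min (r t) x)) - f t (max (l t) (min (r t) y))| +
        |max (-1) (min 1 (x - max (l t) (min (r t) x))) -
          max (-1) (min 1 (y - max (l t) (min (r t) y)))| := by
        refine le_trans (le_of_eq ?_) (abs_add_le _ _)
        simp only [trunc]
        ring_nf
    _ ≤ (K + 2) * |x - y| := by linarith

lemma trunc_bounded (hf : Regular f) (hl : ContinuousOn l (Icc a b))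
    (hr : ContinuousOn r (Icc a b)) :
    ∃ C, ∀ t ∈ Icc a b, ∀ x, |trunc f l r t x| ≤ C := by
  obtain ⟨A, hA⟩ := isCompact_Icc.exists_bound_of_continuousOn hl
  obtain ⟨B, hB⟩ := isCompact_Icc.exists_bound_of_continuousOn hr
  obtain ⟨C, hC⟩ := (isCompact_Icc (a := a) (b := b)).prod
    (isCompact_Icc (a := -max A B) (b := max A B)) |>.exists_bound_of_continuousOn
    hf.cont.continuousOn
  refine ⟨C + 1, fun t ht x => (abs_add_le _ _).trans (add_le_add (hC (t, _) ⟨ht, ?_⟩) ?_)⟩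
  · have h1 := abs_le.1 (hA t ht)
    have h2 := abs_le.1 (hB t ht)
    refine ⟨?_, ?_⟩
    · exact (by linarith [h1.1, le_max_left A B] : -max A B ≤ l t).trans (le_max_left _ _)
    · exact max_le (h1.2.trans (le_max_left _ _))
        ((min_le_left _ _).trans (h2.2.trans (le_max_right _ _)))
  · exact abs_le.2 ⟨le_max_left _ _, max_le (by norm_num) (min_le_left _ _)⟩

end Trunc

/-! ### Reflection of the unknown -/

/-- The nonlinearity satisfied by `-u` when `u` solves `u'' = f t u`. -/
def reflect (f : ℝ → ℝ → ℝ) (t x : ℝ) : ℝ := -f t (-x)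

lemma reflect_reflect (f : ℝ → ℝ → ℝ) : reflect (reflect f) = f := by
  funext t x
  simp [reflect]

lemma Regular.reflect {f : ℝ → ℝ → ℝ} (hf : Regular f) : Regular (reflect f) := by
  refine ⟨(hf.cont.comp (continuous_fst.prodMk continuous_snd.neg)).neg, fun R => ?_⟩
  obtain ⟨K, hK0, hK⟩ := hf.lip R
  refine ⟨K, hK0, fun t x y hx hy => ?_⟩
  have h := hK t (-y) (-x) (by simpa using hy) (by simpa using hx)
  have e1 : _root_.reflect f t x - _root_.reflect f t y = f t (-y) - f t (-x) := by
    simp only [_root_.reflect]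
    ring
  rwa [e1, show x - y = -y - -x by ring]

lemma IsSolOn.reflect {f : ℝ → ℝ → ℝ} {a b : ℝ} {u p : ℝ → ℝ} (h : IsSolOn f a b u p) :
    IsSolOn (reflect f) a b (-u) (-p) := fun t ht => by
  refine ⟨(h t ht).1.neg, ?_⟩
  simpa [_root_.reflect] using (h t ht).2.neg

lemma trunc_reflect (f : ℝ → ℝ → ℝ) {l r : ℝ → ℝ} {t : ℝ} (h : l t ≤ r t) (x : ℝ) :
    trunc (reflect f) (-r) (-l) t x = reflect (trunc f l r) t x := by
  have h1 : max (-r t) (min (-l t) x) = -max (l t) (min (r t) (-x)) := by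
    rcases le_total x (-l t) with h1 | h1 <;> rcases le_total x (-r t) with h2 | h2
    · rw [min_eq_right h1, max_eq_left h2, min_eq_left (by linarith), max_eq_right h]
    · rw [min_eq_right h1, max_eq_right h2, min_eq_right (by linarith),
        max_eq_right (by linarith), neg_neg]
    · rw [min_eq_left h1, max_eq_right (by linarith), min_eq_left (by linarith), max_eq_right h]
      linarith
    · rw [min_eq_left h1, max_eq_right (by linarith), min_eq_right (by linarith),
        max_eq_left (by linarith)]
  have h2 : ∀ y : ℝ, max (-1) (min 1 (-y)) = -max (-1) (min 1 y) := fun y => by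
    rw [← min_neg_neg, ← max_neg_neg, neg_neg, max_min_distrib_left]
    simp
  simp only [trunc, reflect, Pi.neg_apply, h1, neg_neg]
  rw [show x - -max (l t) (min (r t) (-x)) = -(-x - max (l t) (min (r t) (-x))) by ring, h2]
  ring

/-! ### Sub- and supersolutions of the Neumann problem -/

/-- Supersolutions, in the viscosity sense, of the Neumann problem for `u'' = f t u`
on `[0, π]`. -/
def IsSuper (f : ℝ → ℝ → ℝ) (β : ℝ → ℝ) : Prop :=
  ∀ u p : ℝ → ℝ, ∀ t₀ ∈ Icc 0 π, ∀ c : ℝ, (∀ t ∈ Icc 0 π, HasDerivAt u (p t) t) →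
    HasDerivAt p c t₀ → 0 ≤ p 0 → p π ≤ 0 → (∀ t ∈ Icc 0 π, u t - β t ≤ u t₀ - β t₀) →
    c ≤ f t₀ (β t₀)

/-- Subsolutions, in the viscosity sense, of the Neumann problem for `u'' = f t u`
on `[0, π]`. -/
def IsSub (f : ℝ → ℝ → ℝ) (α : ℝ → ℝ) : Prop := IsSuper (reflect f) (-α)

/-- `u`, with derivative `p`, solves the Neumann problem for `u'' = f t u` on `[0, π]`. -/
structure IsNeumann (f : ℝ → ℝ → ℝ) (u p : ℝ → ℝ) : Prop where
  sol : IsSolOn f 0 π u p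
  left : p 0 = 0
  right : p π = 0

section Neumann

variable {f : ℝ → ℝ → ℝ}

lemma IsNeumann.reflect {u p : ℝ → ℝ} (h : IsNeumann f u p) :
    IsNeumann (reflect f) (-u) (-p) :=
  ⟨h.sol.reflect, by simp [h.left], by simp [h.right]⟩

lemma IsNeumann.isSuper {u p : ℝ → ℝ} (h : IsNeumann f u p) : IsSuper f u := by
  intro v q t₀ ht₀ c hv hq h0 hπ hmax
  have := second_deriv_nonpos_of_max (d := fun t => v t - u t) (q := fun t => q t - p t) pi_pos ht₀
    (fun t ht => (hv t ht).sub (h.sol t ht).1) (hq.sub (h.sol t₀ ht₀).2)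
    (by simpa [h.left] using h0) (by simpa [h.right] using hπ) hmax
  linarith

lemma IsNeumann.isSub {u p : ℝ → ℝ} (h : IsNeumann f u p) : IsSub f u := h.reflect.isSuper

lemma isSuper_const {c : ℝ} (h : ∀ t ∈ Icc 0 π, 0 ≤ f t c) : IsSuper f fun _ => c := by
  intro v q t₀ ht₀ m hv hq h0 hπ hmax
  have := second_deriv_nonpos_of_max (d := v) (q := q) pi_pos ht₀ hv hq h0 hπ
    (fun t ht => by linarith [hmax t ht])
  linarith [h t₀ ht₀]

lemma isSub_const {c : ℝ} (h : ∀ t ∈ Icc 0 π, f t c ≤ 0) : IsSub f fun _ => c :=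
  isSuper_const (c := -c) fun t ht => by simpa [_root_.reflect] using h t ht

/-- A solution below a constant at which `f` is positive stays strictly below it. -/
lemma IsNeumann.lt_const {u p : ℝ → ℝ} (h : IsNeumann f u p) {c : ℝ}
    (hc : ∀ t ∈ Icc 0 π, 0 < f t c) (hu : ∀ t ∈ Icc 0 π, u t ≤ c) : ∀ t ∈ Icc 0 π, u t < c := by
  intro t ht
  refine lt_of_le_of_ne (hu t ht) fun heq => ?_
  have := second_deriv_nonpos_of_max (d := u) (q := p) pi_pos ht (fun t ht => (h.sol t ht).1)
    (h.sol t ht).2 h.left.ge h.right.le (fun s hs => heq ▸ hu s hs)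
  rw [heq] at this
  exact absurd (hc t ht) (not_lt.2 this)

/-- A solution above a constant at which `f` is negative stays strictly above it. -/
lemma IsNeumann.const_lt {u p : ℝ → ℝ} (h : IsNeumann f u p) {c : ℝ}
    (hc : ∀ t ∈ Icc 0 π, f t c < 0) (hu : ∀ t ∈ Icc 0 π, c ≤ u t) :
    ∀ t ∈ Icc 0 π, c < u t := fun t ht => by
  have := h.reflect.lt_const (c := -c) (fun t ht => by simpa [_root_.reflect] using hc t ht)
    (fun t ht => by simpa using hu t ht) t ht
  simpa using this

lemma IsSuper.inf {β₁ β₂ : ℝ → ℝ} (h₁ : IsSuper f β₁) (h₂ : IsSuper f β₂) :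
    IsSuper f (β₁ ⊓ β₂) := by
  intro u p t₀ ht₀ c hu hp h0 hπ hmax
  simp only [Pi.inf_apply] at hmax ⊢
  rcases le_total (β₁ t₀) (β₂ t₀) with h | h
  · rw [inf_eq_left.2 h] at hmax ⊢
    exact h₁ u p t₀ ht₀ c hu hp h0 hπ fun t ht => by
      linarith [hmax t ht, (inf_le_left : β₁ t ⊓ β₂ t ≤ β₁ t)]
  · rw [inf_eq_right.2 h] at hmax ⊢
    exact h₂ u p t₀ ht₀ c hu hp h0 hπ fun t ht => by
      linarith [hmax t ht, (inf_le_right : β₁ t ⊓ β₂ t ≤ β₂ t)]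

lemma IsSub.sup {α₁ α₂ : ℝ → ℝ} (h₁ : IsSub f α₁) (h₂ : IsSub f α₂) : IsSub f (α₁ ⊔ α₂) := by
  have h := IsSuper.inf h₁ h₂
  rwa [← neg_sup] at h

/-- Time reversal of supersolutions. -/
lemma IsSuper.reverse {β : ℝ → ℝ} (h : IsSuper f β) :
    IsSuper (fun t x => f (π - t) x) fun t => β (π - t) := by
  intro u p t₀ ht₀ c hu hp h0 hπ hmax
  have hmem : ∀ t ∈ Icc 0 π, π - t ∈ Icc 0 π := fun t ht =>
    ⟨by linarith [ht.2], by linarith [ht.1]⟩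
  refine h (fun t => u (π - t)) (fun t => -p (π - t)) (π - t₀) (hmem t₀ ht₀) c
    (fun t ht => (hu _ (hmem t ht)).comp_const_sub π t) ?_ (by simpa using hπ) (by simpa using h0)
    (fun t ht => ?_)
  · have := (HasDerivAt.comp_const_sub π (π - t₀) (f := p) (f' := c) (by simpa using hp)).fun_neg
    simpa using this
  · have := hmax _ (hmem t ht)
    simpa using this

lemma trunc_of_mem' {l r : ℝ → ℝ} {u p : ℝ → ℝ} (h : IsSolOn f 0 π u p)
    (hl : ∀ t ∈ Icc 0 π, l t ≤ u t) (hr : ∀ t ∈ Icc 0 π, u t ≤ r t) :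
    IsSolOn (trunc f l r) 0 π u p :=
  h.congr fun t ht => (trunc_of_mem (hl t ht) (hr t ht)).symm

/-- Comparison with a supersolution. -/
lemma le_of_isSuper {l r z q : ℝ → ℝ}
    (hr : ContinuousOn r (Icc 0 π)) (hlr : ∀ t ∈ Icc 0 π, l t ≤ r t) (hβ : IsSuper f r)
    (hz : IsSolOn (trunc f l r) 0 π z q) (h0 : q 0 = 0) (hπ : q π ≤ 0) :
    ∀ t ∈ Icc 0 π, z t ≤ r t := by
  obtain ⟨t₀, ht₀, hmax⟩ := isCompact_Icc.exists_isMaxOn ⟨0, le_rfl, pi_pos.le⟩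
    (hz.continuousOn.sub hr)
  by_contra! hex
  obtain ⟨s, hs, hsr⟩ := hex
  have h1 : z s - r s ≤ z t₀ - r t₀ := hmax hs
  have h2 := hβ z q t₀ ht₀ _ (fun t ht => (hz t ht).1) (hz t₀ ht₀).2 h0.ge hπ (fun t ht => hmax ht)
  exact absurd (trunc_of_gt (f := f) (hlr t₀ ht₀) (by linarith : r t₀ < z t₀)) (not_lt.2 h2)

/-- Comparison with a subsolution. -/
lemma ge_of_isSub {l r z q : ℝ → ℝ}
    (hl : ContinuousOn l (Icc 0 π)) (hlr : ∀ t ∈ Icc 0 π, l t ≤ r t) (hα : IsSub f l)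
    (hz : IsSolOn (trunc f l r) 0 π z q) (h0 : q 0 = 0) (hπ : 0 ≤ q π) :
    ∀ t ∈ Icc 0 π, l t ≤ z t := fun t ht => by
  have := le_of_isSuper (f := reflect f) (l := -r) (r := -l) (z := -z) (q := -q) hl.neg
    (fun t ht => neg_le_neg (hlr t ht)) hα
    (hz.reflect.congr fun t ht => (trunc_reflect f (hlr t ht) _).symm)
    (by simp [h0]) (by simpa using hπ) t ht
  simpa using this

lemma IsNeumann.unique (hf : Regular f) {u p v q : ℝ → ℝ} (hu : IsNeumann f u p)
    (hv : IsNeumann f v q) {s t : ℝ} (hs : s ∈ Icc 0 π) (ht : t ∈ Icc 0 π) (h0 : u s = v s)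
    (h1 : p s = q s) : u t = v t := by
  obtain ⟨A, hA⟩ := isCompact_Icc.exists_bound_of_continuousOn hu.sol.continuousOn
  obtain ⟨B, hB⟩ := isCompact_Icc.exists_bound_of_continuousOn hv.sol.continuousOn
  obtain ⟨K, hK0, hK⟩ := hf.lip (max A B)
  exact (hu.sol.unique hv.sol hK0 (fun t ht => hK t _ _ ((hA t ht).trans (le_max_left _ _))
    ((hB t ht).trans (le_max_right _ _))) hs ht h0 h1).1

/-- Ordered solutions of the Neumann problem that differ somewhere are strictly ordered. -/
lemma IsNeumann.lt_of_le (hf : Regular f) {u p v q : ℝ → ℝ} (hu : IsNeumann f u p)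
    (hv : IsNeumann f v q) (hle : ∀ t ∈ Icc 0 π, u t ≤ v t) {s : ℝ} (hs : s ∈ Icc 0 π)
    (hne : u s ≠ v s) : ∀ t ∈ Icc 0 π, u t < v t := by
  intro t ht
  refine lt_of_le_of_ne (hle t ht) fun heq => hne (hu.unique hf hv ht hs heq ?_)
  have := deriv_eq_zero_of_max (d := fun t => u t - v t) (q := fun t => p t - q t) ht
    (fun t ht => (hu.sol t ht).1.sub (hv.sol t ht).1) (by simp [hu.left, hv.left])
    (by simp [hu.right, hv.right]) (fun s hs => by simpa [heq] using hle s hs)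
  linarith

/-! ### Shooting -/

/-- Lipschitz dependence on the initial position for the truncated equation. -/
lemma exists_trunc_dist_le (hf : Regular f) {l r : ℝ → ℝ} (hl : ContinuousOn l (Icc 0 π))
    (hr : ContinuousOn r (Icc 0 π)) :
    ∃ C, 0 ≤ C ∧ ∀ u p v q, IsSolOn (trunc f l r) 0 π u p → IsSolOn (trunc f l r) 0 π v q →
      p 0 = 0 → q 0 = 0 → ∀ t ∈ Icc 0 π,
        |u t - v t| ≤ C * |u 0 - v 0| ∧ |p t - q t| ≤ C * |u 0 - v 0| := by
  obtain ⟨K, hK0, hK⟩ := trunc_lipschitz hf hl hr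
  refine ⟨exp ((1 + K) * π), (exp_pos _).le, fun u p v q hu hv hp hq t ht => ?_⟩
  have h := hu.dist_sq_le hv hK0 (fun t ht => hK t ht _ _) ⟨le_rfl, pi_pos.le⟩ ht
  rw [hp, hq, sub_zero, sub_zero, abs_of_nonneg ht.1] at h
  have h1 : exp ((1 + K) * t) ≤ exp ((1 + K) * π) :=
    exp_le_exp.2 (mul_le_mul_of_nonneg_left ht.2 (by linarith))
  have h2 : 1 ≤ exp ((1 + K) * π) := one_le_exp (mul_nonneg (by linarith) pi_pos.le)
  set M := exp ((1 + K) * π)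
  have h3 : (u t - v t) ^ 2 + (p t - q t) ^ 2 ≤ (M * |u 0 - v 0|) ^ 2 := by
    rw [mul_pow, sq_abs]
    nlinarith [sq_nonneg (u 0 - v 0), mul_nonneg (sq_nonneg (u 0 - v 0)) (sub_nonneg.2 h1),
      mul_nonneg (sq_nonneg (u 0 - v 0)) (mul_nonneg (by linarith : 0 ≤ M) (sub_nonneg.2 h2))]
  have h4 : 0 ≤ M * |u 0 - v 0| := mul_nonneg (by linarith) (abs_nonneg _)
  exact ⟨abs_le_of_sq_le_sq (by nlinarith [sq_nonneg (p t - q t)]) h4,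
    abs_le_of_sq_le_sq (by nlinarith [sq_nonneg (u t - v t)]) h4⟩

/-- The shooting family of the truncated equation. -/
lemma exists_shooting (hf : Regular f) {l r : ℝ → ℝ} (hl : ContinuousOn l (Icc 0 π))
    (hr : ContinuousOn r (Icc 0 π)) :
    ∃ U P : ℝ → ℝ → ℝ, (∀ a, IsSolOn (trunc f l r) 0 π (U a) (P a) ∧ U a 0 = a ∧ P a 0 = 0) ∧
      Continuous fun a => P a π := by
  obtain ⟨K, hK0, hK⟩ := trunc_lipschitz hf hl hr
  obtain ⟨B, hB⟩ := trunc_bounded hf hl hr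
  choose U P hUP using exists_isSolOn pi_pos.le hK0 (trunc_continuousOn hf hl hr) hK hB
  obtain ⟨C, hC0, hC⟩ := exists_trunc_dist_le hf hl hr
  refine ⟨U, P, hUP, (LipschitzWith.of_dist_le_mul (K := ⟨C, hC0⟩) fun x y => ?_).continuous⟩
  have h := (hC _ _ _ _ (hUP x).1 (hUP y).1 (hUP x).2.2 (hUP y).2.2 π ⟨pi_pos.le, le_rfl⟩).2
  rwa [(hUP x).2.1, (hUP y).2.1] at h

/-- A Neumann solution of the truncated equation solves the original equation. -/
lemma isNeumann_of_trunc {l r z q : ℝ → ℝ} (hl : ContinuousOn l (Icc 0 π))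
    (hr : ContinuousOn r (Icc 0 π)) (hlr : ∀ t ∈ Icc 0 π, l t ≤ r t) (hα : IsSub f l)
    (hβ : IsSuper f r) (hz : IsSolOn (trunc f l r) 0 π z q) (h0 : q 0 = 0) (hπ : q π = 0) :
    IsNeumann f z q ∧ (∀ t ∈ Icc 0 π, l t ≤ z t) ∧ ∀ t ∈ Icc 0 π, z t ≤ r t := by
  have h1 := ge_of_isSub hl hlr hα hz h0 hπ.ge
  have h2 := le_of_isSuper hr hlr hβ hz h0 hπ.le
  exact ⟨⟨hz.congr fun t ht => trunc_of_mem (h1 t ht) (h2 t ht), h0, hπ⟩, h1, h2⟩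

/-- `u` is the only Neumann solution between `u` and `β`. -/
def IsolatedAbove (f : ℝ → ℝ → ℝ) (u β : ℝ → ℝ) : Prop :=
  ∀ v q, IsNeumann f v q → (∀ t ∈ Icc 0 π, u t ≤ v t) → (∀ t ∈ Icc 0 π, v t ≤ β t) → v 0 = u 0

/-- `u` is the only Neumann solution between `α` and `u`. -/
def IsolatedBelow (f : ℝ → ℝ → ℝ) (α u : ℝ → ℝ) : Prop :=
  ∀ v q, IsNeumann f v q → (∀ t ∈ Icc 0 π, α t ≤ v t) → (∀ t ∈ Icc 0 π, v t ≤ u t) → v 0 = u 0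

lemma IsolatedBelow.reflect {α u : ℝ → ℝ} (h : IsolatedBelow f α u) :
    IsolatedAbove (reflect f) (-u) (-α) := fun v q hv h1 h2 => by
  have hv' := hv.reflect
  rw [reflect_reflect] at hv'
  have := h (-v) (-q) hv' (fun t ht => by simpa using neg_le_neg (h2 t ht))
    (fun t ht => by simpa using neg_le_neg (h1 t ht))
  simp only [Pi.neg_apply] at this ⊢
  linarith

/-- Between a subsolution and a supersolution there is a solution that is isolated above. -/
lemma exists_isolatedAbove (hf : Regular f) {l r : ℝ → ℝ} (hl : ContinuousOn l (Icc 0 π))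
    (hr : ContinuousOn r (Icc 0 π)) (hlr : ∀ t ∈ Icc 0 π, l t ≤ r t) (hα : IsSub f l)
    (hβ : IsSuper f r) :
    ∃ u p, IsNeumann f u p ∧ (∀ t ∈ Icc 0 π, l t ≤ u t) ∧ (∀ t ∈ Icc 0 π, u t ≤ r t) ∧
      IsolatedAbove f u r := by
  obtain ⟨U, P, hUP, hS⟩ := exists_shooting hf hl hr
  have h0mem : (0 : ℝ) ∈ Icc 0 π := ⟨le_rfl, pi_pos.le⟩
  have hle : ∀ a, P a π ≤ 0 → a ≤ r 0 := fun a ha => by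
    simpa [(hUP a).2.1] using le_of_isSuper hr hlr hβ (hUP a).1 (hUP a).2.2 ha 0 h0mem
  have hge : ∀ a, 0 ≤ P a π → l 0 ≤ a := fun a ha => by
    simpa [(hUP a).2.1] using ge_of_isSub hl hlr hα (hUP a).1 (hUP a).2.2 ha 0 h0mem
  have hcpt : IsCompact {a | P a π = 0} :=
    isCompact_Icc.of_isClosed_subset (isClosed_eq hS continuous_const)
      (fun a (ha : P a π = 0) => (⟨hge a ha.ge, hle a ha.le⟩ : a ∈ Icc (l 0) (r 0)))
  have hne : {a | P a π = 0}.Nonempty := by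
    have h1 : P (l 0 - 1) π ≤ 0 := by
      by_contra! h
      linarith [hge _ h.le]
    have h2 : 0 ≤ P (r 0 + 1) π := by
      by_contra! h
      linarith [hle _ h.le]
    obtain ⟨a, -, ha⟩ := intermediate_value_Icc (by linarith [hlr 0 h0mem] : l 0 - 1 ≤ r 0 + 1)
      hS.continuousOn ⟨h1, h2⟩
    exact ⟨a, ha⟩
  obtain ⟨a, ha, hmax⟩ := hcpt.exists_isGreatest hne
  obtain ⟨h1, h2, h3⟩ := isNeumann_of_trunc hl hr hlr hα hβ (hUP a).1 (hUP a).2.2 ha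
  refine ⟨U a, P a, h1, h2, h3, fun v q hv hv1 hv2 => ?_⟩
  have hvt := trunc_of_mem' hv.sol (fun t ht => (h2 t ht).trans (hv1 t ht)) hv2
  obtain ⟨C, hC0, hC⟩ := exists_trunc_dist_le hf hl hr
  have h := (hC _ _ _ _ (hUP (v 0)).1 hvt (hUP (v 0)).2.2 hv.left π ⟨pi_pos.le, le_rfl⟩).2
  rw [(hUP (v 0)).2.1, hv.right, sub_zero, sub_self, abs_zero, mul_zero] at h
  have h4 : v 0 ≤ a := hmax (abs_eq_zero.1 (le_antisymm h (abs_nonneg _)))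
  rw [(hUP a).2.1]
  exact le_antisymm h4 (by simpa [(hUP a).2.1] using hv1 0 h0mem)

/-- Between a subsolution and a supersolution there is a solution that is isolated below. -/
lemma exists_isolatedBelow (hf : Regular f) {l r : ℝ → ℝ} (hl : ContinuousOn l (Icc 0 π))
    (hr : ContinuousOn r (Icc 0 π)) (hlr : ∀ t ∈ Icc 0 π, l t ≤ r t) (hα : IsSub f l)
    (hβ : IsSuper f r) :
    ∃ u p, IsNeumann f u p ∧ (∀ t ∈ Icc 0 π, l t ≤ u t) ∧ (∀ t ∈ Icc 0 π, u t ≤ r t) ∧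
      IsolatedBelow f l u := by
  have hβ' : IsSub (reflect f) (-r) := by
    rwa [IsSub, reflect_reflect, neg_neg]
  obtain ⟨u, p, hu, h1, h2, h3⟩ := exists_isolatedAbove hf.reflect hr.neg hl.neg
    (fun t ht => neg_le_neg (hlr t ht)) hβ' hα
  have hu' := hu.reflect
  rw [reflect_reflect] at hu'
  refine ⟨-u, -p, hu', fun t ht => by simpa using neg_le_neg (h2 t ht),
    fun t ht => by simpa using neg_le_neg (h1 t ht), fun v q hv hv1 hv2 => ?_⟩
  have := h3 (-v) (-q) hv.reflect (fun t ht => by simpa using neg_le_neg (hv2 t ht))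
    (fun t ht => neg_le_neg (hv1 t ht))
  simp only [Pi.neg_apply] at this ⊢
  linarith

/-- Just above a solution that is isolated above, the shooting function is positive. -/
lemma shooting_pos (hf : Regular f) {u p β v : ℝ → ℝ} (hu : IsNeumann f u p)
    (hβc : ContinuousOn β (Icc 0 π)) (hβ : IsSuper f β) (hvc : ContinuousOn v (Icc 0 π))
    (huβ : ∀ t ∈ Icc 0 π, u t < β t) (huv : ∀ t ∈ Icc 0 π, u t < v t)
    (hiso : IsolatedAbove f u β) :
    ∃ δ > 0, ∀ z q, IsSolOn (trunc f u v) 0 π z q → q 0 = 0 → u 0 < z 0 → z 0 < u 0 + δ →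
      0 < q π := by
  have huc := hu.sol.continuousOn
  have h0mem : (0 : ℝ) ∈ Icc 0 π := ⟨le_rfl, pi_pos.le⟩
  have huβ' : ∀ t ∈ Icc 0 π, u t ≤ β t := fun t ht => (huβ t ht).le
  obtain ⟨U, P, hUP, hS⟩ := exists_shooting hf huc hβc
  have hne : ∀ a, u 0 < a → P a π ≠ 0 := fun a ha h => by
    obtain ⟨h1, h2, h3⟩ := isNeumann_of_trunc huc hβc huβ' hu.isSub hβ (hUP a).1 (hUP a).2.2 h
    have := hiso _ _ h1 h2 h3
    rw [(hUP a).2.1] at this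
    linarith
  have hpos : ∀ a, u 0 < a → 0 < P a π := fun a ha => by
    by_contra! h
    set A := max a (β 0 + 1)
    have hA : 0 ≤ P A π := by
      by_contra! h'
      have := le_of_isSuper hβc huβ' hβ (hUP A).1 (hUP A).2.2 h'.le 0 h0mem
      rw [(hUP A).2.1] at this
      linarith [le_max_right a (β 0 + 1)]
    obtain ⟨c, hc, hc0⟩ := intermediate_value_Icc (le_max_left a (β 0 + 1)) hS.continuousOn ⟨h, hA⟩
    exact hne c (ha.trans_le hc.1) hc0
  obtain ⟨t₀, ht₀, hmin⟩ := isCompact_Icc.exists_isMinOn ⟨0, h0mem⟩ ((hβc.inf hvc).sub huc)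
  have hgap : ∀ t ∈ Icc 0 π, (β t₀ ⊓ v t₀) - u t₀ ≤ (β t ⊓ v t) - u t := fun t ht => hmin ht
  set m := (β t₀ ⊓ v t₀) - u t₀
  have hm : 0 < m := sub_pos.2 (lt_inf_iff.2 ⟨huβ t₀ ht₀, huv t₀ ht₀⟩)
  obtain ⟨C, hC0, hC⟩ := exists_trunc_dist_le hf huc hvc
  refine ⟨m / (C + 1), by positivity, fun z q hz hq hz1 hz2 => ?_⟩
  have hut := trunc_of_mem' (l := u) (r := v) hu.sol (fun t _ => le_rfl)
    (fun t ht => (huv t ht).le)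
  have hzlt : ∀ t ∈ Icc 0 π, z t < β t ∧ z t < v t := fun t ht => by
    have h1 := (hC z q u p hz hut hq hu.left t ht).1
    rw [abs_of_pos (sub_pos.2 hz1)] at h1
    have h2 : z 0 - u 0 < m / (C + 1) := by linarith
    rw [lt_div_iff₀ (by linarith)] at h2
    have h3 : z t - u t < m := by nlinarith [le_abs_self (z t - u t)]
    have h4 := hgap t ht
    exact ⟨by linarith [inf_le_left (a := β t) (b := v t)],
      by linarith [inf_le_right (a := β t) (b := v t)]⟩
  have hzβ : IsSolOn (trunc f u β) 0 π z q := hz.congr fun t ht => by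
    simp only [trunc, min_eq_right (hzlt t ht).1.le, min_eq_right (hzlt t ht).2.le]
  obtain ⟨D, hD0, hD⟩ := exists_trunc_dist_le hf huc hβc
  have h := (hD _ _ _ _ (hUP (z 0)).1 hzβ (hUP (z 0)).2.2 hq π ⟨pi_pos.le, le_rfl⟩).2
  rw [(hUP (z 0)).2.1, sub_self, abs_zero, mul_zero] at h
  have h5 := abs_eq_zero.1 (le_antisymm h (abs_nonneg _))
  linarith [hpos (z 0) hz1]

/-- Just below a solution that is isolated below, the shooting function is negative. -/
lemma shooting_neg (hf : Regular f) {u p α v : ℝ → ℝ} (hu : IsNeumann f u p)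
    (hαc : ContinuousOn α (Icc 0 π)) (hα : IsSub f α) (hvc : ContinuousOn v (Icc 0 π))
    (hαu : ∀ t ∈ Icc 0 π, α t < u t) (hvu : ∀ t ∈ Icc 0 π, v t < u t)
    (hiso : IsolatedBelow f α u) :
    ∃ δ > 0, ∀ z q, IsSolOn (trunc f v u) 0 π z q → q 0 = 0 → z 0 < u 0 → u 0 - δ < z 0 →
      q π < 0 := by
  obtain ⟨δ, hδ, h⟩ := shooting_pos hf.reflect hu.reflect hαc.neg hα hvc.neg
    (fun t ht => neg_lt_neg (hαu t ht)) (fun t ht => neg_lt_neg (hvu t ht)) hiso.reflect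
  refine ⟨δ, hδ, fun z q hz hq hz1 hz2 => ?_⟩
  have := h (-z) (-q)
    (hz.reflect.congr fun t ht => (trunc_reflect f (hvu t ht).le _).symm)
    (by simp [hq]) (by simpa using hz1) (by simp only [Pi.neg_apply]; linarith)
  simpa using this

/-- Between two ordered solutions that are isolated on the facing sides lies a third one. -/
lemma exists_between_isolated (hf : Regular f) {u p v q α β : ℝ → ℝ} (hu : IsNeumann f u p)
    (hv : IsNeumann f v q) (hαc : ContinuousOn α (Icc 0 π)) (hα : IsSub f α)
    (hβc : ContinuousOn β (Icc 0 π)) (hβ : IsSuper f β)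
    (huβ : ∀ t ∈ Icc 0 π, u t < β t) (hαv : ∀ t ∈ Icc 0 π, α t < v t)
    (huv : ∀ t ∈ Icc 0 π, u t < v t) (hiu : IsolatedAbove f u β) (hiv : IsolatedBelow f α v) :
    ∃ z r, IsNeumann f z r ∧ (∀ t ∈ Icc 0 π, u t < z t) ∧ ∀ t ∈ Icc 0 π, z t < v t := by
  have huc := hu.sol.continuousOn
  have hvc := hv.sol.continuousOn
  have h0mem : (0 : ℝ) ∈ Icc 0 π := ⟨le_rfl, pi_pos.le⟩
  have huv' : ∀ t ∈ Icc 0 π, u t ≤ v t := fun t ht => (huv t ht).le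
  obtain ⟨δ₁, hδ₁, h₁⟩ := shooting_pos hf hu hβc hβ hvc huβ huv hiu
  obtain ⟨δ₂, hδ₂, h₂⟩ := shooting_neg hf hv hαc hα huc hαv huv hiv
  obtain ⟨U, P, hUP, hS⟩ := exists_shooting hf huc hvc
  have h0 := huv 0 h0mem
  obtain ⟨a₁, ha₁, ha₁'⟩ := exists_between
    (lt_min (by linarith : u 0 < u 0 + δ₁) (by linarith : u 0 < (u 0 + v 0) / 2))
  obtain ⟨a₂, ha₂', ha₂⟩ := exists_between
    (max_lt (by linarith : v 0 - δ₂ < v 0) (by linarith : (u 0 + v 0) / 2 < v 0))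
  rw [lt_min_iff] at ha₁'
  rw [max_lt_iff] at ha₂'
  have hp := h₁ _ _ (hUP a₁).1 (hUP a₁).2.2 (by rw [(hUP a₁).2.1]; exact ha₁)
    (by rw [(hUP a₁).2.1]; exact ha₁'.1)
  have hn := h₂ _ _ (hUP a₂).1 (hUP a₂).2.2 (by rw [(hUP a₂).2.1]; exact ha₂)
    (by rw [(hUP a₂).2.1]; exact ha₂'.1)
  obtain ⟨a, ha, ha0⟩ := intermediate_value_Icc' (by linarith [ha₁'.2, ha₂'.2] : a₁ ≤ a₂)
    hS.continuousOn ⟨hn.le, hp.le⟩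
  obtain ⟨h3, h4, h5⟩ := isNeumann_of_trunc huc hvc huv' hu.isSub hv.isSuper (hUP a).1
    (hUP a).2.2 ha0
  refine ⟨U a, P a, h3, hu.lt_of_le hf h3 h4 h0mem ?_, h3.lt_of_le hf hv h5 h0mem ?_⟩
  · rw [(hUP a).2.1]
    exact (ha₁.trans_le ha.1).ne
  · rw [(hUP a).2.1]
    exact (ha.2.trans_lt ha₂).ne

end Neumann

/-! ### Supersolutions that follow an increasing layer and then stay constant -/

/-- `w`, with derivative `q`, solves `w'' = f t w` on `[0, T]`, starts with slope zero and increases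
to the value `b`, at which `f` is positive. -/
structure IsLayer (f : ℝ → ℝ → ℝ) (w q : ℝ → ℝ) (T b : ℝ) : Prop where
  pos : 0 < T
  lt_pi : T < π
  sol : IsSolOn f 0 T w q
  left : q 0 = 0
  deriv_pos : ∀ t ∈ Ioc 0 T, 0 < q t
  apex : w T = b
  force_pos : ∀ t ∈ Icc 0 π, 0 < f t b

section Layer

variable {f : ℝ → ℝ → ℝ} {w q : ℝ → ℝ} {T b : ℝ}

lemma IsLayer.touch (h : IsLayer f w q T b) {u p : ℝ → ℝ} {t₀ c : ℝ} (ht₀ : t₀ ∈ Icc 0 π)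
    (hu : ∀ t ∈ Icc 0 π, HasDerivAt u (p t) t) (hp : HasDerivAt p c t₀) (h0 : 0 ≤ p 0)
    (hpi : p π ≤ 0) (hmax : ∀ t ∈ Icc 0 π, u t - w (min t T) ≤ u t₀ - w (min t₀ T)) :
    (t₀ < T ∧ 0 ≤ p t₀ - q t₀ ∧ c ≤ f t₀ (w t₀)) ∨ (T < t₀ ∧ c ≤ 0) := by
  have hT := h.pos
  have hTπ := h.lt_pi
  have hlow : ∀ t ∈ Icc 0 T, HasDerivAt (fun t => u t - w t) (p t - q t) t := fun t ht =>
    (hu t ⟨ht.1, ht.2.trans hTπ.le⟩).sub (h.sol t ht).1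
  have hmaxlow : t₀ ≤ T → ∀ t ∈ Icc 0 T, u t - w t ≤ u t₀ - w t₀ := fun hle t ht => by
    have := hmax t ⟨ht.1, ht.2.trans hTπ.le⟩
    rwa [min_eq_left ht.2, min_eq_left hle] at this
  have hmaxhigh : T ≤ t₀ → ∀ t ∈ Icc T π, u t ≤ u t₀ := fun hle t ht => by
    have := hmax t ⟨hT.le.trans ht.1, ht.2⟩
    rw [min_eq_right ht.1, min_eq_right hle] at this
    linarith
  rcases lt_trichotomy t₀ T with hlt | rfl | hgt
  · left
    have hm := hmaxlow hlt.le
    have hq : 0 ≤ p t₀ - q t₀ := by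
      rcases ht₀.1.eq_or_lt with rfl | hpos
      · rw [h.left]
        linarith
      · exact deriv_nonneg_of_max_right hpos (hlow t₀ ⟨ht₀.1, hlt.le⟩)
          fun t ht => hm t ⟨ht.1, ht.2.trans hlt.le⟩
    have hc := second_deriv_nonpos_of_max_left hlt
      (fun t ht => hlow t ⟨ht₀.1.trans ht.1, ht.2⟩) (hp.sub (h.sol t₀ ⟨ht₀.1, hlt.le⟩).2) hq
      fun t ht => hm t ⟨ht₀.1.trans ht.1, ht.2⟩
    exact ⟨hlt, hq, by linarith⟩
  · have h1 := deriv_nonneg_of_max_right hT (hlow t₀ ⟨hT.le, le_rfl⟩) (hmaxlow le_rfl)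
    have h2 := deriv_nonpos_of_max_left hTπ (hu t₀ ht₀) (hmaxhigh le_rfl)
    have h3 := h.deriv_pos t₀ ⟨hT, le_rfl⟩
    linarith
  · right
    have hm := hmaxhigh hgt.le
    refine ⟨hgt, ?_⟩
    have hq : 0 ≤ p t₀ := deriv_nonneg_of_max_right hgt (hu t₀ ht₀)
      fun t ht => hm t ⟨ht.1, ht.2.trans ht₀.2⟩
    rcases ht₀.2.eq_or_lt with rfl | hlt
    · exact second_deriv_nonpos_of_max_right hgt
        (fun t ht => hu t ⟨hT.le.trans ht.1, ht.2⟩) hp hpi hm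
    · exact second_deriv_nonpos_of_max_left hlt
        (fun t ht => hu t ⟨ht₀.1.trans ht.1, ht.2⟩) hp hq
        fun t ht => hm t ⟨hgt.le.trans ht.1, ht.2⟩

lemma IsLayer.isSuper (h : IsLayer f w q T b) : IsSuper f fun t => w (min t T) := by
  intro u p t₀ ht₀ c hu hp h0 hpi hmax
  rcases h.touch ht₀ hu hp h0 hpi hmax with ⟨hlt, -, hc⟩ | ⟨hgt, hc⟩
  · simpa [min_eq_left hlt.le] using hc
  · simpa [min_eq_right hgt.le, h.apex] using hc.trans (h.force_pos t₀ ht₀).le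

lemma IsLayer.lt (h : IsLayer f w q T b) (hf : Regular f) {u p : ℝ → ℝ} (hu : IsNeumann f u p)
    (hle : ∀ t ∈ Icc 0 π, u t ≤ w (min t T)) : ∀ t ∈ Icc 0 π, u t < w (min t T) := by
  have hT := h.pos
  have hTπ := h.lt_pi
  have key : ∀ t₀ ∈ Icc 0 π, u t₀ = w (min t₀ T) →
      (t₀ < T ∧ 0 ≤ p t₀ - q t₀) ∨ (T < t₀ ∧ f t₀ (u t₀) ≤ 0) := fun t₀ ht₀ he => by
    rcases h.touch ht₀ (fun t ht => (hu.sol t ht).1) (hu.sol t₀ ht₀).2 hu.left.ge hu.right.le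
      (fun t ht => by linarith [hle t ht]) with ⟨h1, h2, -⟩ | h1
    · exact .inl ⟨h1, h2⟩
    · exact .inr h1
  intro t₀ ht₀
  refine (hle t₀ ht₀).lt_of_ne fun he => ?_
  rcases key t₀ ht₀ he with ⟨hlt, hq⟩ | ⟨hgt, hc⟩
  · have hu' : IsSolOn f 0 T u p := fun t ht => hu.sol t ⟨ht.1, ht.2.trans hTπ.le⟩
    have ht₀' : t₀ ∈ Icc 0 T := ⟨ht₀.1, hlt.le⟩
    have hpq : p t₀ = q t₀ := by
      refine le_antisymm ?_ (by linarith)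
      have := deriv_nonpos_of_max_left hlt ((hu' t₀ ht₀').1.sub (h.sol t₀ ht₀').1) fun t ht => by
        have h1 := hle t ⟨ht₀.1.trans ht.1, ht.2.trans hTπ.le⟩
        rw [min_eq_left ht.2] at h1
        rw [min_eq_left hlt.le] at he
        simp only [Pi.sub_apply]
        linarith
      linarith
    obtain ⟨M, hM⟩ := isCompact_Icc.exists_bound_of_continuousOn hu'.continuousOn
    obtain ⟨N, hN⟩ := isCompact_Icc.exists_bound_of_continuousOn h.sol.continuousOn
    obtain ⟨K, hK0, hK⟩ := hf.lip (max M N)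
    rw [min_eq_left hlt.le] at he
    have hend := hu'.unique h.sol hK0
      (fun t ht => hK t _ _ ((hM t ht).trans (le_max_left ..)) ((hN t ht).trans (le_max_right ..)))
      ht₀' ⟨hT.le, le_rfl⟩ he hpq
    rcases key T ⟨hT.le, hTπ.le⟩ (by simpa using hend.1) with h1 | h1
    · exact lt_irrefl _ h1.1
    · exact lt_irrefl _ h1.1
  · rw [he, min_eq_right hgt.le, h.apex] at hc
    exact (h.force_pos t₀ ht₀).not_ge hc

lemma IsLayer.monotoneOn (h : IsLayer f w q T b) : MonotoneOn w (Icc 0 T) := by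
  refine monotoneOn_of_deriv_nonneg (convex_Icc 0 T) h.sol.continuousOn
    (fun t ht => (h.sol t (interior_subset ht)).1.differentiableAt.differentiableWithinAt)
    fun t ht => ?_
  rw [(h.sol t (interior_subset ht)).1.deriv]
  rw [interior_Icc] at ht
  exact (h.deriv_pos t ⟨ht.1, ht.2.le⟩).le

lemma IsLayer.mem_Icc (h : IsLayer f w q T b) {t : ℝ} (ht : t ∈ Icc 0 π) :
    w (min t T) ∈ Icc (w 0) b := by
  have hm : min t T ∈ Icc 0 T := ⟨le_min ht.1 h.pos.le, min_le_right ..⟩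
  refine ⟨h.monotoneOn ⟨le_rfl, h.pos.le⟩ hm hm.1, ?_⟩
  rw [← h.apex]
  exact h.monotoneOn hm ⟨h.pos.le, le_rfl⟩ hm.2

lemma IsLayer.continuousOn (h : IsLayer f w q T b) :
    ContinuousOn (fun t => w (min t T)) (Icc 0 π) :=
  h.sol.continuousOn.comp (by fun_prop) fun _ ht => ⟨le_min ht.1 h.pos.le, min_le_right ..⟩

end Layer

/-! ### Symmetry under `t ↦ π - t`, `x ↦ -x` -/

section Symmetry

variable {f : ℝ → ℝ → ℝ}

lemma IsSuper.isSub_reverse (hs : ∀ t x, -f t (-x) = f (π - t) x) {β : ℝ → ℝ} (h : IsSuper f β) :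
    IsSub f fun t => -β (π - t) := by
  have e : reflect f = fun t x => f (π - t) x := funext fun t => funext fun x => hs t x
  have e' : (-fun t => -β (π - t)) = fun t => β (π - t) := funext fun t => neg_neg _
  rw [IsSub, e, e']
  exact h.reverse

lemma IsNeumann.neg_reverse (hs : ∀ t x, -f t (-x) = f (π - t) x) {u p : ℝ → ℝ}
    (h : IsNeumann f u p) : IsNeumann f (fun t => -u (π - t)) fun t => p (π - t) := by
  refine ⟨fun t ht => ?_, by simpa using h.right, by simpa using h.left⟩
  have ht' : π - t ∈ Icc 0 π := ⟨by linarith [ht.2], by linarith [ht.1]⟩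
  obtain ⟨h1, h2⟩ := h.sol (π - t) ht'
  refine ⟨(HasDerivAt.comp_const_sub π t h1).fun_neg.congr_deriv (neg_neg _),
    (HasDerivAt.comp_const_sub π t h2).congr_deriv ?_⟩
  have := hs (π - t) (-u (π - t))
  rwa [neg_neg, sub_sub_cancel] at this

end Symmetry

/-! ### Periodic extension of Neumann solutions -/

lemma intervalIntegral_odd_of_even {g : ℝ → ℝ} (hg : ∀ t, g (-t) = g t) (t : ℝ) :
    ∫ s in (0 : ℝ)..(-t), g s = -∫ s in (0 : ℝ)..t, g s := by
  have h := intervalIntegral.integral_comp_neg g (a := 0) (b := t)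
  simp only [hg, neg_zero] at h
  rw [h, intervalIntegral.integral_symm]

lemma intervalIntegral_even_of_odd {g : ℝ → ℝ} (hg : ∀ t, g (-t) = -g t) (t : ℝ) :
    ∫ s in (0 : ℝ)..(-t), g s = ∫ s in (0 : ℝ)..t, g s := by
  have h := intervalIntegral.integral_comp_neg g (a := 0) (b := t)
  simp only [hg, neg_zero, intervalIntegral.integral_neg] at h
  rw [intervalIntegral.integral_symm, ← h, neg_neg]

lemma intervalIntegral_periodic {g : ℝ → ℝ} {c : ℝ} (hc : Continuous g)
    (hp : Function.Periodic g (2 * c)) (h0 : ∫ s in (-c)..c, g s = 0) :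
    Function.Periodic (fun t => ∫ s in (0 : ℝ)..t, g s) (2 * c) := by
  intro t
  have hi : ∀ a b : ℝ, IntervalIntegrable g MeasureTheory.volume a b :=
    fun a b => hc.intervalIntegrable a b
  have h1 := hp.intervalIntegral_add_eq t (-c)
  rw [show -c + 2 * c = c by ring, h0] at h1
  have h2 := intervalIntegral.integral_add_adjacent_intervals (hi 0 t) (hi t (t + 2 * c))
  simp only
  rw [← h2, h1, add_zero]

lemma eq_comp_arccos_cos {U : ℝ → ℝ} (he : ∀ t, U (-t) = U t)
    (hp : Function.Periodic U (2 * π)) (t : ℝ) : U t = U (arccos (cos t)) := by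
  have h : cos (arccos (cos t)) = cos t := cos_arccos (neg_one_le_cos t) (cos_le_one t)
  generalize arccos (cos t) = a at h
  obtain ⟨k, rfl | rfl⟩ := Real.cos_eq_cos_iff.1 h
  · rw [show 2 * k * π + a = a + k * (2 * π) by ring, hp.int_mul k]
  · rw [show 2 * k * π - a = -a + k * (2 * π) by ring, hp.int_mul k, he]

lemma arccos_cos_mem_Icc (t : ℝ) : arccos (cos t) ∈ Icc 0 π := ⟨arccos_nonneg _, arccos_le_pi _⟩

/-- Even `2π`-periodic extension of a solution of the Neumann problem on `[0, π]`. -/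
lemma IsNeumann.exists_periodic {f : ℝ → ℝ → ℝ} (hf : Regular f) (heven : ∀ t x, f (-t) x = f t x)
    (hper : ∀ t x, f (t + 2 * π) x = f t x) {u p : ℝ → ℝ} (h : IsNeumann f u p) :
    ∃ P : ℝ → ℝ, P 0 = 0 ∧ P π = 0 ∧
      Function.Periodic (fun t => u (arccos (cos t))) (2 * π) ∧
      ∀ t, HasDerivAt (fun t => u (arccos (cos t))) (P t) t ∧
        HasDerivAt P (f t (u (arccos (cos t)))) t := by
  set v : ℝ → ℝ := fun t => u (arccos (cos t)) with hv
  have hve : ∀ t, v (-t) = v t := fun t => by simp [hv]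
  have hvp : Function.Periodic v (2 * π) := fun t => by simp [hv]
  have hvu : ∀ t ∈ Icc 0 π, v t = u t := fun t ht => by simp [hv, arccos_cos ht.1 ht.2]
  have hvc : Continuous v := h.sol.continuousOn.comp_continuous
    (continuous_arccos.comp continuous_cos) arccos_cos_mem_Icc
  set g : ℝ → ℝ := fun t => f t (v t) with hg
  have hgc : Continuous g := hf.cont.comp (continuous_id.prodMk hvc)
  have hge : ∀ t, g (-t) = g t := fun t => by simp only [hg, hve, heven]
  have hgp : Function.Periodic g (2 * π) := fun t => by simp only [hg, hvp t, hper]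
  set P : ℝ → ℝ := fun t => ∫ s in (0 : ℝ)..t, g s with hP
  have hPd : ∀ t, HasDerivAt P (g t) t := fun t =>
    intervalIntegral.integral_hasDerivAt_right (hgc.intervalIntegrable _ _)
      (hgc.stronglyMeasurableAtFilter _ _) hgc.continuousAt
  have hPc : Continuous P := continuous_iff_continuousAt.2 fun t => (hPd t).continuousAt
  have hsub : ∀ t ∈ Icc 0 π, uIcc 0 t ⊆ Icc 0 π := fun t ht => by
    rw [uIcc_of_le ht.1]
    exact Icc_subset_Icc_right ht.2
  have hPp : ∀ t ∈ Icc 0 π, P t = p t := fun t ht => by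
    have := intervalIntegral.integral_eq_sub_of_hasDerivAt (f := p) (f' := g) (a := 0) (b := t)
      (fun s hs => (h.sol s (hsub t ht hs)).2.congr_deriv (by
        simp only [hg, hvu s (hsub t ht hs)])) (hgc.intervalIntegrable _ _)
    simpa [h.left] using this
  have hPodd : ∀ t, P (-t) = -P t := intervalIntegral_odd_of_even hge
  have hP0 : P 0 = 0 := by simp [hP]
  have hPpi : P π = 0 := by rw [hPp π ⟨pi_pos.le, le_rfl⟩, h.right]
  have hPper : Function.Periodic P (2 * π) := by
    refine intervalIntegral_periodic hgc hgp ?_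
    rw [← intervalIntegral.integral_interval_sub_left (hgc.intervalIntegrable 0 π)
      (hgc.intervalIntegrable 0 (-π))]
    change P π - P (-π) = 0
    rw [hPodd, hPpi]
    simp
  set U : ℝ → ℝ := fun t => u 0 + ∫ s in (0 : ℝ)..t, P s with hU
  have hUd : ∀ t, HasDerivAt U (P t) t := fun t =>
    (intervalIntegral.integral_hasDerivAt_right (hPc.intervalIntegrable _ _)
      (hPc.stronglyMeasurableAtFilter _ _) hPc.continuousAt).const_add _
  have hUu : ∀ t ∈ Icc 0 π, U t = u t := fun t ht => by
    have := intervalIntegral.integral_eq_sub_of_hasDerivAt (f := u) (f' := P) (a := 0) (b := t)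
      (fun s hs => (h.sol s (hsub t ht hs)).1.congr_deriv (hPp s (hsub t ht hs)).symm)
      (hPc.intervalIntegrable _ _)
    simp only [hU, this]
    ring
  have hUe : ∀ t, U (-t) = U t := fun t => by
    simp only [hU, intervalIntegral_even_of_odd hPodd]
  have hUp : Function.Periodic U (2 * π) := by
    have h0 : ∫ s in (-π)..π, P s = 0 := by
      rw [← intervalIntegral.integral_interval_sub_left (hPc.intervalIntegrable 0 π)
        (hPc.intervalIntegrable 0 (-π)), intervalIntegral_even_of_odd hPodd, sub_self]
    exact fun t => congrArg (u 0 + ·) (intervalIntegral_periodic hPc hPper h0 t)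
  have hUv : U = v := funext fun t => by
    rw [eq_comp_arccos_cos hUe hUp t, hUu _ (arccos_cos_mem_Icc t)]
  exact ⟨P, hP0, hPpi, hvp, fun t => ⟨hUv ▸ hUd t, hPd t⟩⟩

/-! ### The forced Duffing equation -/

/-- Right-hand side of the Duffing equation solved for `u''`. -/
noncomputable def duffing (ε lam t x : ℝ) : ℝ := (x ^ 3 - lam * x + cos t) / ε ^ 2

lemma regular_duffing (ε lam : ℝ) : Regular (duffing ε lam) := by
  refine ⟨by unfold duffing; fun_prop, fun R => ?_⟩
  refine ⟨(3 * R ^ 2 + |lam|) / ε ^ 2, by positivity, fun t x y hx hy => ?_⟩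
  have e : duffing ε lam t x - duffing ε lam t y =
      (x ^ 2 + x * y + y ^ 2 - lam) * (x - y) / ε ^ 2 := by
    simp only [duffing]
    ring
  have hR : 0 ≤ R := (abs_nonneg x).trans hx
  rw [e, abs_div, abs_mul, abs_of_nonneg (sq_nonneg ε), div_mul_eq_mul_div]
  gcongr
  rw [abs_le] at hx hy
  have h1 : |x ^ 2 + x * y + y ^ 2| ≤ 3 * R ^ 2 := by
    rw [abs_of_nonneg (by nlinarith [sq_nonneg (x + y), sq_nonneg x, sq_nonneg y])]
    nlinarith [sq_nonneg (x - y), mul_nonneg (sub_nonneg.2 hx.1) (sub_nonneg.2 hx.2),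
      mul_nonneg (sub_nonneg.2 hy.1) (sub_nonneg.2 hy.2)]
  exact (abs_sub _ _).trans (add_le_add_left h1 _)

lemma IsNeumann.isPeriodicBdySol {ε lam : ℝ} (hε : 0 < ε) {u p : ℝ → ℝ}
    (h : IsNeumann (duffing ε lam) u p) :
    IsPeriodicBdySol ε lam fun t => u (arccos (cos t)) := by
  obtain ⟨P, hP0, hPpi, hper, hd⟩ := h.exists_periodic (regular_duffing ε lam)
    (fun t x => by simp [duffing]) (fun t x => by simp [duffing])
  set v : ℝ → ℝ := fun t => u (arccos (cos t))
  have hv : deriv v = P := funext fun t => (hd t).1.deriv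
  have hP : deriv P = fun t => duffing ε lam t (v t) := funext fun t => (hd t).2.deriv
  have hvd : Differentiable ℝ v := fun t => (hd t).1.differentiableAt
  refine ⟨?_, fun t => ?_, hper, by rw [hv, hP0], by rw [hv, hPpi]⟩
  · have h1 : ContDiff ℝ 1 P := contDiff_one_iff_deriv.2
      ⟨fun t => (hd t).2.differentiableAt, by
        rw [hP]
        exact (regular_duffing ε lam).cont.comp (continuous_id.prodMk hvd.continuous)⟩
    rw [show (2 : WithTop ℕ∞) = 1 + 1 by norm_num, contDiff_succ_iff_deriv]
    exact ⟨hvd, by simp, hv ▸ h1⟩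
  · rw [hv, hP]
    simp only [duffing]
    field_simp

/-- Multiplicity for a symmetric Neumann problem with a layer: two constant barriers `-s`, `s` of
opposite sign together with a layer rising from below `-s` to a supersolution `b > s`. -/
lemma exists_five_neumann {f : ℝ → ℝ → ℝ} (hf : Regular f)
    (hs : ∀ t x, -f t (-x) = f (π - t) x) {w q : ℝ → ℝ} {T b s : ℝ} (h : IsLayer f w q T b)
    (hT : T < π / 2) (hs0 : 0 < s) (hsb : s ≤ b) (hfs : ∀ t ∈ Icc 0 π, 0 < f t (-s))
    (hbw : -b ≤ w 0) (hws : w 0 < -s) :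
    ∃ u₁ u₂ u₃ u₄ u₅ p₁ p₂ p₃ p₄ p₅ : ℝ → ℝ,
      IsNeumann f u₁ p₁ ∧ IsNeumann f u₂ p₂ ∧ IsNeumann f u₃ p₃ ∧ IsNeumann f u₄ p₄ ∧
      IsNeumann f u₅ p₅ ∧
      ∀ t ∈ Icc 0 π, u₁ t < u₂ t ∧ u₂ t < u₃ t ∧ u₃ t < u₄ t ∧ u₄ t < u₅ t := by
  have hTpos := h.pos
  have hrev : ∀ t ∈ Icc 0 π, π - t ∈ Icc 0 π :=
    fun t ht => ⟨by linarith [ht.2], by linarith [ht.1]⟩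
  have hneg : ∀ c, (∀ t ∈ Icc 0 π, 0 < f t c) → ∀ t ∈ Icc 0 π, f t (-c) < 0 := fun c hc t ht => by
    have := hc _ (hrev t ht)
    rw [← hs] at this
    linarith
  have hfs' : ∀ t ∈ Icc 0 π, f t s < 0 := by simpa using hneg (-s) hfs
  have h0 : (0 : ℝ) ∈ Icc 0 π := ⟨le_rfl, pi_pos.le⟩
  have hπ : π ∈ Icc 0 π := ⟨pi_pos.le, le_rfl⟩
  set ψ : ℝ → ℝ := fun t => w (min t T) with hψ
  have hψ0 : ψ 0 = w 0 := by simp [hψ, hTpos.le]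
  have hψm : ∀ t ∈ Icc 0 π, ψ t ∈ Icc (w 0) b := fun t ht => h.mem_Icc ht
  have hψc : ContinuousOn ψ (Icc 0 π) := h.continuousOn
  have hψs : IsSuper f ψ := h.isSuper
  have hψlt : ∀ u p, IsNeumann f u p → (∀ t ∈ Icc 0 π, u t ≤ ψ t) → ∀ t ∈ Icc 0 π, u t < ψ t :=
    fun u p hu => h.lt hf hu
  set φ : ℝ → ℝ := fun t => -ψ (π - t) with hφ
  have hφπ : φ π = -w 0 := by simp [hφ, hψ0]
  have hφc : ContinuousOn φ (Icc 0 π) := (hψc.comp (by fun_prop) hrev).neg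
  have hφs : IsSub f φ := hψs.isSub_reverse hs
  have hφlt : ∀ u p, IsNeumann f u p → (∀ t ∈ Icc 0 π, φ t ≤ u t) →
      ∀ t ∈ Icc 0 π, φ t < u t := fun u p hu hle t ht => by
    have := hψlt _ _ (hu.neg_reverse hs) (fun t ht => by
      have := hle _ (hrev t ht)
      simp only [hφ, sub_sub_cancel] at this
      linarith) _ (hrev t ht)
    simp only [sub_sub_cancel] at this
    simp only [hφ]
    linarith
  have hφψ : ∀ t ∈ Icc 0 π, φ t ≤ ψ t := fun t ht => by
    have h1 := hψm t ht
    have h2 := hψm _ (hrev t ht)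
    simp only [hφ]
    rcases le_total t T with hle | hle
    · have : ψ (π - t) = b := by
        simp only [hψ]
        rw [min_eq_right (by linarith), h.apex]
      linarith [h1.1]
    · have : ψ t = b := by
        simp only [hψ]
        rw [min_eq_right hle, h.apex]
      linarith [h2.1]
  have hsupb : IsSuper f fun _ => b := isSuper_const fun t ht => (h.force_pos t ht).le
  have hsubb : IsSub f fun _ => -b := isSub_const fun t ht => (hneg b h.force_pos t ht).le
  have hsups : IsSuper f fun _ => -s := isSuper_const fun t ht => (hfs t ht).le
  have hsubs : IsSub f fun _ => s := isSub_const fun t ht => (hfs' t ht).le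
  -- the lowest solution
  have hβc : ContinuousOn ((fun _ => -s) ⊓ ψ) (Icc 0 π) := continuousOn_const.inf hψc
  obtain ⟨u₁, p₁, hu₁, -, hu₁β, hiso₁⟩ := exists_isolatedAbove hf continuousOn_const hβc
    (fun t ht => le_inf (by linarith) (hbw.trans (hψm t ht).1)) hsubb (hsups.inf hψs)
  have hu₁s := hu₁.lt_const hfs fun t ht => (hu₁β t ht).trans inf_le_left
  have hu₁ψ := hψlt _ _ hu₁ fun t ht => (hu₁β t ht).trans inf_le_right
  -- the middle solution
  obtain ⟨u₃, p₃, hu₃, hu₃α, hu₃ψ, hiso₃⟩ := exists_isolatedBelow hf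
    (hφc.sup hu₁.sol.continuousOn) hψc
    (fun t ht => sup_le (hφψ t ht) (hu₁ψ t ht).le) (hφs.sup hu₁.isSub) hψs
  have hu₃φ := hφlt _ _ hu₃ fun t ht => le_sup_left.trans (hu₃α t ht)
  have hu₁₃ := hu₁.lt_of_le hf hu₃ (fun t ht => le_sup_right.trans (hu₃α t ht)) hπ
    (by linarith [hu₃φ π hπ, hu₁s π hπ] : u₁ π < u₃ π).ne
  obtain ⟨u₂, p₂, hu₂, hu₁₂, hu₂₃⟩ := exists_between_isolated hf hu₁ hu₃
    (hφc.sup hu₁.sol.continuousOn) (hφs.sup hu₁.isSub) hβc (hsups.inf hψs)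
    (fun t ht => lt_inf_iff.2 ⟨hu₁s t ht, hu₁ψ t ht⟩)
    (fun t ht => sup_lt_iff.2 ⟨hu₃φ t ht, hu₁₃ t ht⟩) hu₁₃ hiso₁ hiso₃
  -- the highest solution
  have hαc : ContinuousOn ((fun _ => s) ⊔ u₃) (Icc 0 π) :=
    continuousOn_const.sup hu₃.sol.continuousOn
  obtain ⟨u₅, p₅, hu₅, hu₅α, -, hiso₅⟩ := exists_isolatedBelow hf hαc continuousOn_const
    (fun t ht => sup_le hsb ((hu₃ψ t ht).trans (hψm t ht).2)) (hsubs.sup hu₃.isSub) hsupb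
  have hu₅s := hu₅.const_lt hfs' fun t ht => le_sup_left.trans (hu₅α t ht)
  have hu₃₅ : ∀ t ∈ Icc 0 π, u₃ t ≤ u₅ t := fun t ht => le_sup_right.trans (hu₅α t ht)
  have hlow : ∀ {x : ℝ}, x ≤ ψ 0 → x < u₅ 0 := fun hx => by linarith [hu₅s 0 h0]
  -- the highest solution below the layer
  have hβc' : ContinuousOn (ψ ⊓ u₅) (Icc 0 π) := hψc.inf hu₅.sol.continuousOn
  obtain ⟨v, r, hv, hu₃v, hvβ, hisov⟩ := exists_isolatedAbove hf hu₃.sol.continuousOn hβc'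
    (fun t ht => le_inf (hu₃ψ t ht) (hu₃₅ t ht)) hu₃.isSub (hψs.inf hu₅.isSuper)
  have hvψ := hψlt _ _ hv fun t ht => (hvβ t ht).trans inf_le_left
  have hv₅ := hv.lt_of_le hf hu₅ (fun t ht => (hvβ t ht).trans inf_le_right) h0
    (hlow (hvψ 0 h0).le).ne
  have hu₃₅' := hu₃.lt_of_le hf hu₅ hu₃₅ h0 (hlow (hu₃ψ 0 h0)).ne
  obtain ⟨u₄, p₄, hu₄, hv₄, hu₄₅⟩ := exists_between_isolated hf hv hu₅ hαc (hsubs.sup hu₃.isSub)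
    hβc' (hψs.inf hu₅.isSuper) (fun t ht => lt_inf_iff.2 ⟨hvψ t ht, hv₅ t ht⟩)
    (fun t ht => sup_lt_iff.2 ⟨hu₅s t ht, hu₃₅' t ht⟩) hv₅ hisov hiso₅
  exact ⟨u₁, u₂, u₃, u₄, u₅, p₁, p₂, p₃, p₄, p₅, hu₁, hu₂, hu₃, hu₄, hu₅, fun t ht =>
    ⟨hu₁₂ t ht, hu₂₃ t ht, (hu₃v t ht).trans_lt (hv₄ t ht), hu₄₅ t ht⟩⟩

lemma lt_cube_of_critical_lt {lam : ℝ} (hlam : (3 : ℝ) / (2 : ℝ) ^ ((2 : ℝ) / 3) < lam) :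
    27 / 4 < lam ^ 3 := by
  have h : ((3 : ℝ) / (2 : ℝ) ^ ((2 : ℝ) / 3)) ^ 3 = 27 / 4 := by
    rw [div_pow, ← Real.rpow_natCast ((2 : ℝ) ^ ((2 : ℝ) / 3)), ← Real.rpow_mul (by norm_num)]
    norm_num
  rw [← h]
  gcongr

/-- If `λ > λ₀ = 3/2^(2/3)` and Condition A holds, the forced Duffing equation
has at least five `2π`-periodic solutions `u₁ < u₂ < u₃ < u₄ < u₅`, each with
vanishing derivative at `0` and at `π`. -/
theorem stmt_10 (ε lam b α₀ abar T : ℝ) (w : ℝ → ℝ)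
    (hε : 0 < ε) (hlam : (3 : ℝ) / (2 : ℝ) ^ ((2 : ℝ) / 3) < lam)
    (hb : 0 < b) (hb3 : 1 < b ^ 3 - lam * b)
    (hα₀root : α₀ ^ 3 - lam * α₀ + 1 = 0)
    (hα₀least : ∀ y : ℝ, y ^ 3 - lam * y + 1 = 0 → α₀ ≤ y)
    (habar1 : α₀ < abar) (habar2 : abar < -Real.sqrt (lam / 3))
    (hT1 : 0 < T) (hT2 : T < π / 2)
    (hw : ContDiff ℝ 2 w)
    (hweq : ∀ t ∈ Icc (0 : ℝ) T,
      ε ^ 2 * deriv (deriv w) t = w t ^ 3 - lam * w t + Real.cos t)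
    (hw0 : w 0 = abar) (hw0' : deriv w 0 = 0)
    (hwmono : ∀ t ∈ Ioc (0 : ℝ) T, 0 < deriv w t) (hwT : w T = b) :
    ∃ u₁ u₂ u₃ u₄ u₅ : ℝ → ℝ,
      IsPeriodicBdySol ε lam u₁ ∧ IsPeriodicBdySol ε lam u₂ ∧
      IsPeriodicBdySol ε lam u₃ ∧ IsPeriodicBdySol ε lam u₄ ∧
      IsPeriodicBdySol ε lam u₅ ∧
      ∀ t : ℝ, u₁ t < u₂ t ∧ u₂ t < u₃ t ∧ u₃ t < u₄ t ∧ u₄ t < u₅ t := by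
  have hlam3 := lt_cube_of_critical_lt hlam
  have hlam0 : 0 < lam := (by positivity : (0 : ℝ) < 3 / (2 : ℝ) ^ ((2 : ℝ) / 3)).trans hlam
  set s := Real.sqrt (lam / 3) with hsdef
  have hs0 : 0 < s := Real.sqrt_pos.2 (by positivity)
  have hs2 : lam = 3 * s ^ 2 := by
    rw [hsdef, Real.sq_sqrt (by positivity)]
    ring
  have hs3 : 1 < 2 * s ^ 3 := by
    rw [hs2] at hlam3
    nlinarith [pow_pos hs0 3]
  have hb2 : lam < b ^ 2 := by
    by_contra! hle
    nlinarith
  have hsb : s ≤ b := by nlinarith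
  have hbα : -b < α₀ := by
    by_contra! hle
    nlinarith [mul_nonneg (sub_nonneg.2 hle) (sub_nonneg.2 hb2.le), sq_nonneg (α₀ + b), sq_nonneg α₀,
      mul_nonneg (sub_nonneg.2 hle) (sq_nonneg α₀), mul_nonneg (sub_nonneg.2 hle) (sq_nonneg b)]
  have hw1 : ContDiff ℝ 1 (deriv w) := by
    rw [show (2 : WithTop ℕ∞) = 1 + 1 by norm_num, contDiff_succ_iff_deriv] at hw
    exact hw.2.2
  have hpos : ∀ x, 1 < x ^ 3 - lam * x → ∀ t ∈ Icc 0 π, 0 < duffing ε lam t x :=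
    fun x hx t _ => div_pos (by linarith [neg_one_le_cos t]) (by positivity)
  have hlayer : IsLayer (duffing ε lam) w (deriv w) T b := by
    refine ⟨hT1, by linarith [pi_pos], fun t ht => ⟨?_, ?_⟩, hw0', hwmono, hwT, hpos b hb3⟩
    · exact (hw.differentiable (by norm_num) t).hasDerivAt
    · refine (hw1.differentiable (by norm_num) t).hasDerivAt.congr_deriv ?_
      rw [duffing, ← hweq t ht]
      field_simp
  obtain ⟨u₁, u₂, u₃, u₄, u₅, p₁, p₂, p₃, p₄, p₅, h₁, h₂, h₃, h₄, h₅, hord⟩ :=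
    exists_five_neumann (regular_duffing ε lam)
      (fun t x => by
        simp only [duffing, cos_pi_sub]
        ring)
      hlayer hT2 hs0 hsb (hpos (-s) (by nlinarith)) (by rw [hw0]; linarith) (by rwa [hw0])
  exact ⟨_, _, _, _, _, h₁.isPeriodicBdySol hε, h₂.isPeriodicBdySol hε, h₃.isPeriodicBdySol hε,
    h₄.isPeriodicBdySol hε, h₅.isPeriodicBdySol hε, fun t => hord _ (arccos_cos_mem_Icc t)⟩
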